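/- arXiv:2504.19899 — 4 statements merged into one kernel-verified Lean document; each statement's English description precedes it below -/
import Mathlib

section
/- Let P = (p_1,…,p_r) be a family of essentially distinct integral polynomials. Then for every k ≥ 1, WP_k(P) ⊆ WP_{k+1}(P). -/
open MeasureTheory Polynomial Filter

noncomputable section

/-- An integral polynomial: a real polynomial taking integer values on the integers. -/
def IsIntegralPoly (p : Polynomial ℝ) : Prop := ∀ n : ℤ, ∃ m : ℤ, p.eval (n : ℝ) = (m : ℝ)

/-- The integer value of an (integral) polynomial at an integer. -/
def ieval (p : Polynomial ℝ) (n : ℤ) : ℤ := ⌊p.eval (n : ℝ)⌋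

/-- A family of polynomials is essentially distinct if each member and each
difference of two distinct members is non-constant. -/
def EssentiallyDistinct {r : ℕ} (P : Fin r → Polynomial ℝ) : Prop :=
  (∀ i, 0 < (P i).natDegree) ∧ ∀ i j, i ≠ j → 0 < (P i - P j).natDegree

/-- `p^[j]`: the polynomial `x ↦ p(x)(p(x)-1)⋯(p(x)-j+1)/j!`. -/
def pbr (p : Polynomial ℝ) (j : ℕ) : Polynomial ℝ :=
  Polynomial.C (1 / (Nat.factorial j : ℝ)) * ∏ i ∈ Finset.range j, (p - Polynomial.C (i : ℝ))

/-- The matrix `Λ_k(P)(x)`.  Rows are indexed by pairs `(i, m) ∈ Fin k × Fin r`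
(zero-based), the pair `(i, m)` corresponding to row `i·r + m + 1` in the one-based
numbering: the entry in row `(i, m)` and column `c` is `p_m^{[i−c+1]}(x)` if `c ≤ i`
and `0` otherwise. -/
def Lam {r : ℕ} (P : Fin r → Polynomial ℝ) (k : ℕ) (x : ℝ) :
    Matrix (Fin k × Fin r) (Fin k) ℝ := fun ρ c =>
  if (c : ℕ) ≤ (ρ.1 : ℕ) then (pbr (P ρ.2) ((ρ.1 : ℕ) - (c : ℕ) + 1)).eval x else 0

/-- The `k`-Weyl polynomials generated by the family `P` (with `WP P 0 = {0}`
by convention).  `WP P 1` is the real span of the members of `P`; for `k ≥ 2`,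
`WP P k` is the set of real polynomials of the form `x ↦ (vᵀ Λ_k(P)(x))₁` where
`v ∈ ℝ^{kr}` is such that its vector `w` of last `(k−1)r` coordinates satisfies
`wᵀ Λ_{k−1}(P)(x) = 0` for all `x`. -/
def WP {r : ℕ} (P : Fin r → Polynomial ℝ) : ℕ → Set (Polynomial ℝ)
  | 0 => {0}
  | 1 => (Submodule.span ℝ (Set.range P) : Submodule ℝ (Polynomial ℝ))
  | (k + 2) => { q | ∃ v : Fin (k + 2) × Fin r → ℝ,
      (∀ x : ℝ, Matrix.vecMul (fun w : Fin (k + 1) × Fin r => v (w.1.succ, w.2))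
          (Lam P (k + 1) x) = 0) ∧
      ∀ x : ℝ, q.eval x = Matrix.vecMul v (Lam P (k + 2) x) 0 }

end

noncomputable section

lemma pbr_one (p : Polynomial ℝ) : pbr p 1 = p := by
  simp [pbr]

/-- Extend a coefficient vector by a zero block at the end. -/
def extendZero {k r : ℕ} (v : Fin k × Fin r → ℝ) : Fin (k + 1) × Fin r → ℝ := fun w =>
  if h : (w.1 : ℕ) < k then v (⟨w.1, h⟩, w.2) else 0

lemma vecMul_Lam_extendZero {r k : ℕ} (P : Fin r → Polynomial ℝ) (v : Fin k × Fin r → ℝ)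
    (x : ℝ) (c : Fin k) :
    Matrix.vecMul (extendZero v) (Lam P (k + 1) x) c.castSucc =
      Matrix.vecMul v (Lam P k x) c := by
  simp [Matrix.vecMul, dotProduct, Fintype.sum_prod_type, Fin.sum_univ_castSucc, extendZero, Lam]

lemma vecMul_Lam_extendZero_last {r k : ℕ} (P : Fin r → Polynomial ℝ) (v : Fin k × Fin r → ℝ)
    (x : ℝ) :
    Matrix.vecMul (extendZero v) (Lam P (k + 1) x) (Fin.last k) = 0 := by
  simp only [Matrix.vecMul, dotProduct]
  refine Finset.sum_eq_zero fun w _ => ?_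
  by_cases h : (w.1 : ℕ) < k
  · simp [Lam, Nat.not_le.mpr h]
  · simp [extendZero, h]

lemma extendZero_succ {k r : ℕ} (v : Fin (k + 1) × Fin r → ℝ) :
    (fun w : Fin (k + 1) × Fin r => extendZero v (w.1.succ, w.2)) =
      extendZero fun w : Fin k × Fin r => v (w.1.succ, w.2) := by
  funext w
  simp [extendZero]

/-- The sequence `k ↦ WP_k(P)` of sets of Weyl polynomials is nondecreasing for `k ≥ 1`. -/
theorem stmt2 {r : ℕ} (P : Fin r → Polynomial ℝ)
    (hint : ∀ m, IsIntegralPoly (P m)) (hed : EssentiallyDistinct P)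
    (k : ℕ) (hk : 1 ≤ k) :
    WP P k ⊆ WP P (k + 1) := by
  intro q hq
  match k, hk with
  | 1, _ =>
    obtain ⟨a, rfl⟩ := (Submodule.mem_span_range_iff_exists_fun ℝ).mp hq
    refine ⟨extendZero fun w : Fin 1 × Fin r => a w.2, fun x => ?_, fun x => ?_⟩
    · ext c
      simp [Matrix.vecMul, dotProduct, extendZero]
    · rw [← Fin.castSucc_zero, vecMul_Lam_extendZero]
      simp [Matrix.vecMul, dotProduct, Fintype.sum_prod_type, Lam, pbr_one,
        Polynomial.eval_finsetSum]
  | k + 2, _ =>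
    obtain ⟨v, hv, hqv⟩ := hq
    refine ⟨extendZero v, fun x => ?_, fun x => ?_⟩
    · rw [extendZero_succ]
      ext c
      refine Fin.lastCases ?_ (fun c => ?_) c
      · exact vecMul_Lam_extendZero_last P _ x
      · rw [vecMul_Lam_extendZero, hv x]
        rfl
    · rw [hqv x, ← vecMul_Lam_extendZero, Fin.castSucc_zero]

end
end

section
/- Let P = (p_1,…,p_r) be a family of essentially distinct integral polynomials, let q be a non-constant integral polynomial, and let d ∈ ℕ. Then WP_d(P∘q) = { f∘q : f ∈ WP_d(P) }, where P∘q denotes the family (p_1∘q, …, p_r∘q). -/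
open MeasureTheory Polynomial Filter

noncomputable section

theorem pbr_comp (p q : Polynomial ℝ) (j : ℕ) : pbr (p.comp q) j = (pbr p j).comp q := by
  simp [pbr, Polynomial.prod_comp]

theorem Lam_comp {r : ℕ} (P : Fin r → Polynomial ℝ) (q : Polynomial ℝ) (k : ℕ) (x : ℝ) :
    Lam (fun m => (P m).comp q) k x = Lam P k (q.eval x) := by
  ext ρ c
  simp only [Lam, pbr_comp, Polynomial.eval_comp]

/-- The coordinates of `vᵀ Λ_k(P)(x)` are polynomial functions of `x`. -/
theorem exists_eval_eq_vecMul_Lam {r : ℕ} (P : Fin r → Polynomial ℝ) (k : ℕ)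
    (v : Fin k × Fin r → ℝ) (c : Fin k) :
    ∃ f : Polynomial ℝ, ∀ x : ℝ, f.eval x = Matrix.vecMul v (Lam P k x) c := by
  refine ⟨∑ ρ : Fin k × Fin r, Polynomial.C (v ρ) *
    (if (c : ℕ) ≤ (ρ.1 : ℕ) then pbr (P ρ.2) ((ρ.1 : ℕ) - (c : ℕ) + 1) else 0), fun x => ?_⟩
  simp only [Matrix.vecMul, dotProduct, Lam, Polynomial.eval_finsetSum, Polynomial.eval_mul,
    Polynomial.eval_C, apply_ite (Polynomial.eval x), Polynomial.eval_zero]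

/-- A polynomial vanishing on the range of a non-constant polynomial is zero. -/
theorem eq_zero_of_eval_eval_eq_zero {f q : Polynomial ℝ} (hq : 0 < q.natDegree)
    (h : ∀ x : ℝ, f.eval (q.eval x) = 0) : f = 0 := by
  have hcomp : f.comp q = 0 := Polynomial.funext fun x => by simp [h x]
  rcases Polynomial.comp_eq_zero_iff.1 hcomp with hf | ⟨-, hc⟩
  · exact hf
  · rw [hc, Polynomial.natDegree_C] at hq
    exact absurd hq (lt_irrefl 0)

theorem forall_vecMul_Lam_comp_eq_zero_iff {r : ℕ} (P : Fin r → Polynomial ℝ) {q : Polynomial ℝ}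
    (hq : 0 < q.natDegree) (k : ℕ) (v : Fin k × Fin r → ℝ) :
    (∀ x : ℝ, Matrix.vecMul v (Lam (fun m => (P m).comp q) k x) = 0) ↔
      ∀ x : ℝ, Matrix.vecMul v (Lam P k x) = 0 := by
  simp only [Lam_comp]
  refine ⟨fun h x => ?_, fun h x => h _⟩
  ext c
  obtain ⟨f, hf⟩ := exists_eval_eq_vecMul_Lam P k v c
  have hf0 : f = 0 := eq_zero_of_eval_eval_eq_zero hq fun y => by rw [hf, h y, Pi.zero_apply]
  rw [← hf x, hf0, Polynomial.eval_zero, Pi.zero_apply]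

/-- `WP_d(P∘q) = { f∘q : f ∈ WP_d(P) }` for a non-constant integral polynomial `q`. -/
theorem stmt5 {r : ℕ} (d : ℕ) (hd : 1 ≤ d)
    (P : Fin r → Polynomial ℝ)
    (hPint : ∀ m, IsIntegralPoly (P m)) (hPed : EssentiallyDistinct P)
    (q : Polynomial ℝ) (hqint : IsIntegralPoly q) (hq : 0 < q.natDegree) :
    WP (fun m => (P m).comp q) d = (fun f : Polynomial ℝ => f.comp q) '' (WP P d) := by
  match d, hd with
  | 1, _ =>
    have h := Submodule.map_span (Polynomial.aeval (R := ℝ) q).toLinearMap (Set.range P)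
    rw [← Set.range_comp] at h
    exact (congrArg (fun S : Submodule ℝ (Polynomial ℝ) => (S : Set (Polynomial ℝ))) h).symm
  | k + 2, _ =>
    ext g
    simp only [WP, Set.mem_image, Set.mem_ofPred_eq, forall_vecMul_Lam_comp_eq_zero_iff P hq]
    constructor
    · rintro ⟨v, hv, hg⟩
      obtain ⟨f, hf⟩ := exists_eval_eq_vecMul_Lam P (k + 2) v 0
      refine ⟨f, ⟨v, hv, hf⟩, Polynomial.funext fun x => ?_⟩
      rw [Polynomial.eval_comp, hf, hg, Lam_comp]
    · rintro ⟨f, ⟨v, hv, hf⟩, rfl⟩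
      exact ⟨v, hv, fun x => by rw [Polynomial.eval_comp, hf, Lam_comp]⟩

end
end

section
/- Let r ∈ ℕ and let P = (p_1,…,p_r) where p_m(x) = a_m x with a_1,…,a_r pairwise distinct nonzero integers. Then the union ⋃_{d ≥ 1} WP_d(P) equals the ℝ-linear span of the monomials x, x², …, x^r inside the space of real polynomials. -/
open MeasureTheory Polynomial Filter

noncomputable section


theorem pbr_C_mul_X_coeff (a : ℝ) (j n : ℕ) :
    (pbr (C a * X) j).coeff n = a ^ n * (pbr X j).coeff n := by
  have h : pbr (C a * X) j = (pbr X j).comp (C a * X) := by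
    simp [pbr, Polynomial.prod_comp]
  rw [h, comp_C_mul_X_coeff, mul_comm]

theorem natDegree_pbr_X_le (j : ℕ) : (pbr X j).natDegree ≤ j := by
  refine (natDegree_C_mul_le _ _).trans ?_
  rw [natDegree_finsetProd_X_sub_C_eq_card, Finset.card_range]

theorem coeff_self_pbr_X_ne_zero (j : ℕ) : (pbr X j).coeff j ≠ 0 := by
  have hm : (∏ i ∈ Finset.range j, (X - C (i : ℝ))).Monic :=
    monic_prod_of_monic _ _ fun i _ => monic_X_sub_C _
  have h : (∏ i ∈ Finset.range j, (X - C (i : ℝ))).coeff j = 1 := by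
    have := hm.coeff_natDegree
    rwa [natDegree_finsetProd_X_sub_C_eq_card, Finset.card_range] at this
  rw [pbr, coeff_C_mul, h]
  have := Nat.factorial_pos j
  positivity

theorem coeff_zero_pbr_X_succ (j : ℕ) : (pbr X (j + 1)).coeff 0 = 0 := by
  rw [coeff_zero_eq_eval_zero, pbr, Finset.prod_range_succ']
  simp

/-- The polynomial whose value at `x` is the entry with index `c` of `vᵀ Λ_k(P)(x)`, for
`P = (a₁x, …, a_r x)`. -/
def weylColumn {k r : ℕ} (a : Fin r → ℝ) (v : Fin k × Fin r → ℝ) (c : ℕ) : ℝ[X] :=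
  ∑ i : Fin k, if c ≤ (i : ℕ) then
    ∑ m, C (v (i, m)) * pbr (C (a m) * X) ((i : ℕ) - c + 1) else 0

theorem eval_weylColumn {k r : ℕ} (a : Fin r → ℝ) (v : Fin k × Fin r → ℝ) (c : Fin k) (x : ℝ) :
    (weylColumn a v c).eval x =
      Matrix.vecMul v (Lam (fun m => C (a m) * X) k x) c := by
  rw [weylColumn, eval_finsetSum, Matrix.vecMul, dotProduct, Fintype.sum_prod_type]
  refine Finset.sum_congr rfl fun i _ => ?_
  by_cases h : (c : ℕ) ≤ i <;> simp [Lam, h, eval_finsetSum]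

theorem coeff_weylColumn {k r : ℕ} (a : Fin r → ℝ) (v : Fin k × Fin r → ℝ) (c n : ℕ) :
    (weylColumn a v c).coeff n = ∑ i : Fin k, if c ≤ (i : ℕ) then
      (∑ m, v (i, m) * a m ^ n) * (pbr X ((i : ℕ) - c + 1)).coeff n else 0 := by
  rw [weylColumn, finsetSum_coeff]
  refine Finset.sum_congr rfl fun i _ => ?_
  split_ifs
  · rw [finsetSum_coeff, Finset.sum_mul]
    simp only [coeff_C_mul, pbr_C_mul_X_coeff, mul_assoc]
  · simp

theorem coeff_zero_weylColumn {k r : ℕ} (a : Fin r → ℝ) (v : Fin k × Fin r → ℝ) (c : ℕ) :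
    (weylColumn a v c).coeff 0 = 0 := by
  simp [coeff_weylColumn, coeff_zero_pbr_X_succ]

theorem moment_eq_zero_of_weylColumn_eq_zero {k r : ℕ} {a : Fin r → ℝ}
    {w : Fin k × Fin r → ℝ} (hw : ∀ c : Fin k, weylColumn a w c = 0)
    {n : ℕ} (hn : 1 ≤ n) (i : Fin k) (hi : n ≤ (i : ℕ) + 1) :
    ∑ m, w (i, m) * a m ^ n = 0 := by
  induction hd : k - (i : ℕ) using Nat.strong_induction_on generalizing i with
  | _ d ih =>
    have hc : (i : ℕ) + 1 - n < k := by omega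
    have h : (weylColumn a w ((i : ℕ) + 1 - n)).coeff n = 0 := by
      rw [hw ⟨_, hc⟩, coeff_zero]
    rw [coeff_weylColumn, Finset.sum_eq_single i, if_pos (by omega),
      show (i : ℕ) - (i + 1 - n) + 1 = n by omega] at h
    · exact (mul_eq_zero.1 h).resolve_right (coeff_self_pbr_X_ne_zero n)
    · intro j _ hj
      split_ifs with hcj
      · rcases lt_or_gt_of_ne (fun h => hj (Fin.ext h) : (j : ℕ) ≠ i) with hlt | hgt
        · rw [coeff_eq_zero_of_natDegree_lt ((natDegree_pbr_X_le _).trans_lt (by omega)),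
            mul_zero]
        · rw [ih (k - (j : ℕ)) (by omega) j (by omega) rfl, zero_mul]
      · rfl
    · simp

theorem eq_zero_of_moments_eq_zero {r : ℕ} {a : Fin r → ℝ} (ha : ∀ i, a i ≠ 0)
    (hinj : Function.Injective a) {u : Fin r → ℝ}
    (hu : ∀ e : Fin r, ∑ m, u m * a m ^ ((e : ℕ) + 1) = 0) : u = 0 := by
  have h : (fun m => u m * a m) = 0 :=
    Matrix.eq_zero_of_forall_pow_sum_mul_pow_eq_zero hinj fun e => by
      rw [← hu e]
      exact Finset.sum_congr rfl fun m _ => by ring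
  funext m
  exact (mul_eq_zero.1 (congrFun h m)).resolve_right (ha m)

theorem exists_moments_eq {r : ℕ} {a : Fin r → ℝ} (ha : ∀ i, a i ≠ 0)
    (hinj : Function.Injective a) (t : Fin r → ℝ) :
    ∃ u : Fin r → ℝ, ∀ e : Fin r, ∑ m, u m * a m ^ ((e : ℕ) + 1) = t e := by
  let f : (Fin r → ℝ) →ₗ[ℝ] (Fin r → ℝ) :=
    Matrix.vecMulLinear (Matrix.of fun m e : Fin r => a m ^ ((e : ℕ) + 1))
  have hf : Function.Injective f := by
    rw [injective_iff_map_eq_zero]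
    exact fun u hu => eq_zero_of_moments_eq_zero ha hinj fun e => congrFun hu e
  obtain ⟨u, hu⟩ := LinearMap.injective_iff_surjective.1 hf t
  exact ⟨u, fun e => congrFun hu e⟩

theorem mem_span_X_pow_succ_iff {r : ℕ} {q : ℝ[X]} :
    q ∈ Submodule.span ℝ (Set.range fun j : Fin r => (X : ℝ[X]) ^ ((j : ℕ) + 1)) ↔
      q.coeff 0 = 0 ∧ ∀ n, r < n → q.coeff n = 0 := by
  constructor
  · intro hq
    obtain ⟨c, rfl⟩ := (Submodule.mem_span_range_iff_exists_fun ℝ).1 hq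
    refine ⟨by simp [finsetSum_coeff, coeff_X_pow], fun n hn => ?_⟩
    rw [finsetSum_coeff]
    refine Finset.sum_eq_zero fun j _ => ?_
    rw [coeff_smul, coeff_X_pow, if_neg (by omega), smul_zero]
  · rintro ⟨h0, h⟩
    refine (Submodule.mem_span_range_iff_exists_fun ℝ).2 ⟨fun j => q.coeff (j + 1), ?_⟩
    ext n
    simp only [finsetSum_coeff, coeff_smul, coeff_X_pow, smul_eq_mul, mul_ite, mul_one, mul_zero]
    rcases n with _ | n
    · simp [h0]
    · by_cases hn : n < r
      · rw [Finset.sum_eq_single ⟨n, hn⟩]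
        · simp
        · exact fun j _ hj => if_neg fun h => hj (Fin.ext (by simpa using h.symm))
        · simp
      · rw [h _ (by omega)]
        exact Finset.sum_eq_zero fun j _ => if_neg (by omega)

theorem mem_WP_add_two_iff {r : ℕ} (a : Fin r → ℝ) (k : ℕ) (q : ℝ[X]) :
    q ∈ WP (fun m => C (a m) * X) (k + 2) ↔ ∃ v : Fin (k + 2) × Fin r → ℝ,
      (∀ c : Fin (k + 1),
        weylColumn a (fun w : Fin (k + 1) × Fin r => v (w.1.succ, w.2)) c = 0) ∧
      q = weylColumn a v 0 := by
  refine exists_congr fun v => and_congr ?_ ?_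
  · constructor
    · refine fun h c => Polynomial.funext fun x => ?_
      rw [eval_weylColumn, h, eval_zero, Pi.zero_apply]
    · refine fun h x => _root_.funext fun c => ?_
      rw [← eval_weylColumn, h, eval_zero, Pi.zero_apply]
  · have h0 (x : ℝ) := eval_weylColumn a v 0 x
    constructor
    · exact fun h => Polynomial.funext fun x => (h x).trans (h0 x).symm
    · rintro rfl x
      exact h0 x

theorem WP_subset_span {r : ℕ} {a : Fin r → ℝ} (ha : ∀ i, a i ≠ 0)
    (hinj : Function.Injective a) (d : ℕ) :
    WP (fun m => C (a m) * X) d ⊆ (Submodule.span ℝ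
      (Set.range fun j : Fin r => (X : ℝ[X]) ^ ((j : ℕ) + 1)) : Submodule ℝ ℝ[X]) := by
  match d with
  | 0 =>
    rintro q rfl
    exact Submodule.zero_mem _
  | 1 =>
    refine Submodule.span_le.2 ?_
    rintro _ ⟨m, rfl⟩
    have hm := m.pos
    refine mem_span_X_pow_succ_iff.2 ⟨by simp, fun n hn => ?_⟩
    rw [coeff_C_mul, coeff_X_of_ne_one (by omega), mul_zero]
  | k + 2 =>
    intro q hq
    obtain ⟨v, hv, rfl⟩ := (mem_WP_add_two_iff a k q).1 hq
    refine mem_span_X_pow_succ_iff.2 ⟨coeff_zero_weylColumn _ _ _, fun n hn => ?_⟩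
    rw [coeff_weylColumn]
    refine Finset.sum_eq_zero fun i _ => ?_
    rw [if_pos (Nat.zero_le _)]
    by_cases hi : r ≤ i
    · suffices (fun m => v (i, m)) = 0 by
        simp [fun m => congrFun this m]
      refine eq_zero_of_moments_eq_zero ha hinj fun e => ?_
      have he := e.isLt
      obtain ⟨j, rfl⟩ := Fin.exists_succ_eq.2
        (show i ≠ 0 by rintro rfl; simp at hi; omega)
      rw [Fin.val_succ] at hi
      exact moment_eq_zero_of_weylColumn_eq_zero hv (Nat.le_add_left 1 e) j (by omega)
    · rw [coeff_eq_zero_of_natDegree_lt ((natDegree_pbr_X_le _).trans_lt (by omega)), mul_zero]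

theorem span_subset_WP {r : ℕ} {a : Fin r → ℝ} (ha : ∀ i, a i ≠ 0)
    (hinj : Function.Injective a) :
    ((Submodule.span ℝ (Set.range fun j : Fin r => (X : ℝ[X]) ^ ((j : ℕ) + 1)) :
      Submodule ℝ ℝ[X]) : Set ℝ[X]) ⊆ WP (fun m => C (a m) * X) (r + 2) := by
  intro q hq
  obtain ⟨h0, hr⟩ := mem_span_X_pow_succ_iff.1 hq
  choose b hb using fun i : ℕ => exists_moments_eq ha hinj fun e : Fin r =>
    if (e : ℕ) = i then q.coeff (i + 1) / (pbr X (i + 1)).coeff (i + 1) else 0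
  -- the moments of order at most `i` of `v (i, ·)` vanish
  let v : Fin (r + 2) × Fin r → ℝ := fun ρ => if (ρ.1 : ℕ) < r then b ρ.1 ρ.2 else 0
  have hv (i : Fin (r + 2)) (n : ℕ) (hn : n ≤ i) : ∑ m, v (i, m) * a m ^ (n + 1) =
      if n = i then q.coeff (i + 1) / (pbr X ((i : ℕ) + 1)).coeff (i + 1) else 0 := by
    by_cases hi : (i : ℕ) < r
    · simpa [v, hi] using hb i ⟨n, by omega⟩
    · simp [v, hi, hr (i + 1) (by omega)]
  refine (mem_WP_add_two_iff a r q).2 ⟨v, fun c => ?_, ?_⟩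
  · ext n
    rcases n with _ | n
    · rw [coeff_zero_weylColumn, coeff_zero]
    rw [coeff_weylColumn, coeff_zero]
    refine Finset.sum_eq_zero fun i _ => ?_
    split_ifs with hci
    · by_cases hn : n ≤ i
      · rw [hv i.succ n (by simp; omega), if_neg (by simp; omega), zero_mul]
      · rw [coeff_eq_zero_of_natDegree_lt ((natDegree_pbr_X_le _).trans_lt (by omega)), mul_zero]
    · rfl
  · ext n
    rcases n with _ | n
    · rw [coeff_zero_weylColumn, h0]
    rw [coeff_weylColumn]
    have hterm (i : Fin (r + 2)) : (if 0 ≤ (i : ℕ) then (∑ m, v (i, m) * a m ^ (n + 1)) *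
        (pbr X ((i : ℕ) - 0 + 1)).coeff (n + 1) else 0) =
        if n = i then q.coeff (n + 1) else 0 := by
      rw [if_pos (Nat.zero_le _), Nat.sub_zero]
      by_cases hn : n ≤ i
      · rw [hv i n hn]
        split_ifs with h
        · rw [← h, div_mul_cancel₀ _ (coeff_self_pbr_X_ne_zero _)]
        · rw [zero_mul]
      · rw [coeff_eq_zero_of_natDegree_lt ((natDegree_pbr_X_le _).trans_lt (by omega)), mul_zero,
          if_neg (by omega)]
    rw [Finset.sum_congr rfl fun i _ => hterm i]
    by_cases hn : n < r + 2
    · rw [Finset.sum_eq_single ⟨n, hn⟩]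
      · simp
      · exact fun j _ hj => if_neg fun h => hj (Fin.ext h.symm)
      · simp
    · rw [hr _ (by omega)]
      simp

/-- For the family `P = (a₁x, …, a_r x)` with `a₁,…,a_r` pairwise distinct nonzero
integers, the union `⋃_{d ≥ 1} WP_d(P)` is the real span of `x, x², …, x^r`. -/
theorem stmt6 (r : ℕ) (a : Fin r → ℤ) (ha : ∀ i, a i ≠ 0)
    (hinj : Function.Injective a) :
    (⋃ d ∈ {d : ℕ | 1 ≤ d},
        WP (fun m => Polynomial.C ((a m : ℝ)) * Polynomial.X) d) =
      (Submodule.span ℝ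
        (Set.range fun j : Fin r => (Polynomial.X : Polynomial ℝ) ^ ((j : ℕ) + 1)) :
          Submodule ℝ (Polynomial ℝ)) := by
  have ha' (i : Fin r) : (a i : ℝ) ≠ 0 := Int.cast_ne_zero.2 (ha i)
  have hinj' : Function.Injective fun i => (a i : ℝ) := Int.cast_injective.comp hinj
  refine Set.Subset.antisymm (Set.iUnion₂_subset fun d _ => WP_subset_span ha' hinj' d) ?_
  exact (span_subset_WP ha' hinj').trans
    (Set.subset_biUnion_of_mem (u := WP fun m => C (a m : ℝ) * X)
      (show r + 2 ∈ {d : ℕ | 1 ≤ d} by simp))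

end
end

section
/- Let p_1,…,p_r be essentially distinct integral polynomials (r ≥ 1) and let d ∈ ℕ. Then WP_d(p_1,…,p_r) = WP_d(p_1 − p_r, p_2 − p_r, …, p_{r−1} − p_r, −p_r). -/
open MeasureTheory Polynomial Filter

noncomputable section

lemma eval_pbr (p : Polynomial ℝ) (j : ℕ) (x : ℝ) :
    (pbr p j).eval x = Ring.choose (p.eval x) j := by
  rw [Ring.choose_eq_smul, ← Polynomial.aeval_eq_smeval, Polynomial.aeval_def,
    Polynomial.eval₂_eq_eval_map, descPochhammer_map, descPochhammer_eval_eq_prod_range]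
  simp [pbr, Polynomial.eval_prod]

/-- The family `(p₁ − p_r, …, p_{r−1} − p_r, −p_r)`. -/
def pivot {r : ℕ} (P : Fin (r + 1) → Polynomial ℝ) (i : Fin (r + 1)) : Polynomial ℝ :=
  if i = Fin.last r then -(P (Fin.last r)) else P i - P (Fin.last r)

lemma pivot_pivot {r : ℕ} (P : Fin (r + 1) → Polynomial ℝ) : pivot (pivot P) = P := by
  funext i
  by_cases h : i = Fin.last r <;> simp [pivot, h]

/-- The coefficients with respect to `pivot P` corresponding to the coefficients `v` with
respect to `P`. -/
def pivotCoeff {ι : Type*} {r : ℕ} (v : ι × Fin (r + 1) → ℝ) (ρ : ι × Fin (r + 1)) : ℝ :=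
  if ρ.2 = Fin.last r then -∑ m, v (ρ.1, m) else v ρ

/-- The lower triangular Toeplitz matrix of the binomial coefficients of `b`. -/
def chooseToeplitz (k : ℕ) (b : ℝ) : Matrix (Fin k) (Fin k) ℝ := fun i c =>
  if c ≤ i then Ring.choose b ((i : ℕ) - c) else 0

/-- A form of the Chu–Vandermonde identity. -/
lemma sum_choose_succ_mul_choose (a b : ℝ) (n : ℕ) :
    ∑ j ∈ Finset.range (n + 1), Ring.choose a (n - j + 1) * Ring.choose b j =
      Ring.choose (a + b) (n + 1) - Ring.choose b (n + 1) := by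
  rw [add_comm a b, Ring.add_choose_eq (n + 1) (Commute.all b a),
    Finset.Nat.sum_antidiagonal_eq_sum_range_succ
      (fun i j : ℕ => Ring.choose b i * Ring.choose a j), Finset.sum_range_succ _ (n + 1)]
  simp only [Nat.sub_self, Ring.choose_zero_right, mul_one, add_sub_cancel_right]
  refine Finset.sum_congr rfl fun j hj => ?_
  rw [mul_comm, Nat.succ_sub (Finset.mem_range_succ_iff.mp hj)]

lemma sum_choose_mul_chooseToeplitz {k : ℕ} (a b : ℝ) (i c : Fin k) :
    ∑ e : Fin k, (if (e : ℕ) ≤ i then Ring.choose a ((i : ℕ) - e + 1) else 0) *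
        chooseToeplitz k b e c =
      if (c : ℕ) ≤ i then
        Ring.choose (a + b) ((i : ℕ) - c + 1) - Ring.choose b ((i : ℕ) - c + 1) else 0 := by
  simp only [chooseToeplitz, Fin.le_def]
  rw [Fin.sum_univ_eq_sum_range (fun e : ℕ =>
    (if e ≤ (i : ℕ) then Ring.choose a ((i : ℕ) - e + 1) else 0) *
      if (c : ℕ) ≤ e then Ring.choose b (e - c) else 0) k]
  split_ifs with h
  · rw [← sum_choose_succ_mul_choose]
    have hsub : Finset.Ico (c : ℕ) (i + 1) ⊆ Finset.range k := fun e he => by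
      simp only [Finset.mem_Ico, Finset.mem_range] at he ⊢
      omega
    rw [← Finset.sum_subset hsub, Finset.sum_Ico_eq_sum_range, Nat.succ_sub h]
    · refine Finset.sum_congr rfl fun j hj => ?_
      have hj' := Finset.mem_range.mp hj
      rw [if_pos (by omega), if_pos (by omega), Nat.add_sub_cancel_left, Nat.sub_add_eq]
    · intro e _ he
      rw [Finset.mem_Ico] at he
      split_ifs <;> first | omega | simp
  · refine Finset.sum_eq_zero fun e _ => ?_
    split_ifs <;> first | omega | simp

lemma sum_pivotCoeff_mul_choose {ι : Type*} {r : ℕ} (P : Fin (r + 1) → Polynomial ℝ)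
    (v : ι × Fin (r + 1) → ℝ) (i : ι) (n : ℕ) (x : ℝ) :
    ∑ m, pivotCoeff v (i, m) * Ring.choose ((pivot P m).eval x) (n + 1) =
      ∑ m, v (i, m) * (Ring.choose ((P m).eval x + -(P (Fin.last r)).eval x) (n + 1) -
        Ring.choose (-(P (Fin.last r)).eval x) (n + 1)) := by
  simp only [mul_sub, Finset.sum_sub_distrib, ← Finset.sum_mul]
  rw [Fin.sum_univ_castSucc, Fin.sum_univ_castSucc
    (fun m => v (i, m) * Ring.choose ((P m).eval x + -(P (Fin.last r)).eval x) (n + 1))]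
  simp [pivotCoeff, pivot, Fin.castSucc_ne_last, Ring.choose_zero_succ, sub_eq_add_neg]

lemma vecMul_Lam_pivot {r k : ℕ} (P : Fin (r + 1) → Polynomial ℝ)
    (v : Fin k × Fin (r + 1) → ℝ) (x : ℝ) :
    Matrix.vecMul (pivotCoeff v) (Lam (pivot P) k x) =
      Matrix.vecMul (Matrix.vecMul v (Lam P k x))
        (chooseToeplitz k (-(P (Fin.last r)).eval x)) := by
  ext c
  rw [Matrix.vecMul_vecMul]
  simp only [Matrix.vecMul, dotProduct, Matrix.mul_apply, Lam, eval_pbr,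
    sum_choose_mul_chooseToeplitz, Fintype.sum_prod_type]
  refine Finset.sum_congr rfl fun i _ => ?_
  split_ifs with h
  · exact sum_pivotCoeff_mul_choose P v i _ x
  · simp

lemma vecMul_Lam_succ {r k : ℕ} (P : Fin r → Polynomial ℝ)
    (v : Fin (k + 1) × Fin r → ℝ) (x : ℝ) (c : Fin k) :
    Matrix.vecMul v (Lam P (k + 1) x) c.succ =
      Matrix.vecMul (fun w : Fin k × Fin r => v (w.1.succ, w.2)) (Lam P k x) c := by
  simp [Matrix.vecMul, dotProduct, Lam, Fintype.sum_prod_type, Fin.sum_univ_succ]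

lemma WP_subset_WP_pivot {r : ℕ} (P : Fin (r + 1) → Polynomial ℝ) :
    ∀ d, WP P d ⊆ WP (pivot P) d
  | 0 => subset_rfl
  | 1 => by
    refine Submodule.span_le.mpr ?_
    have hmem (i) : pivot P i ∈ Submodule.span ℝ (Set.range (pivot P)) :=
      Submodule.subset_span ⟨i, rfl⟩
    have hlast := hmem (Fin.last r)
    rintro _ ⟨i, rfl⟩
    by_cases hi : i = Fin.last r
    · subst hi
      simpa [pivot] using neg_mem hlast
    · simpa [pivot, hi] using sub_mem (hmem i) hlast
  | k + 2 => by
    rintro q ⟨v, hv, hq⟩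
    refine ⟨pivotCoeff v, fun x => ?_, fun x => ?_⟩
    · have h := vecMul_Lam_pivot P (fun w : Fin (k + 1) × Fin (r + 1) => v (w.1.succ, w.2)) x
      rw [hv x, Matrix.zero_vecMul] at h
      exact h
    · rw [vecMul_Lam_pivot, Matrix.vecMul, dotProduct, Fin.sum_univ_succ]
      simp [vecMul_Lam_succ, hv x, hq x, chooseToeplitz]

/-- `WP_d(p₁,…,p_r) = WP_d(p₁ − p_r, …, p_{r−1} − p_r, −p_r)` (here the family is
indexed by `Fin (r+1)`, so that the last index plays the role of `p_r`). -/
theorem stmt9 {r : ℕ} (d : ℕ) (hd : 1 ≤ d)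
    (P : Fin (r + 1) → Polynomial ℝ)
    (hint : ∀ m, IsIntegralPoly (P m)) (hed : EssentiallyDistinct P) :
    WP P d =
      WP (fun i : Fin (r + 1) =>
        if i = Fin.last r then -(P (Fin.last r)) else P i - P (Fin.last r)) d := by
  refine (WP_subset_WP_pivot P d).antisymm ?_
  have h := WP_subset_WP_pivot (pivot P) d
  rwa [pivot_pivot] at h

end
end
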